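/- arXiv:2405.08709 — 2 statements merged into one kernel-verified Lean document; each statement's English description precedes it below -/
import Mathlib

section
/- Let S, Y be random variables on a probability space with values in nonempty finite sets such that H(S|Y) = 0 (S is a deterministic function of Y), and let 0 ≤ ε < I(S;Y). Then there exist a probability space carrying random variables S', Y' whose joint distribution equals that of (S,Y) and a finite-valued random variable U such that I(U;S') ≤ ε and I(U;Y') = H(Y|S) + ε; moreover, for every finite-valued U with I(U;S') ≤ ε one has I(U;Y') ≤ H(Y|S) + ε. Hence when H(S|Y)=0 the optimal privacy–utility trade-off value equals H(Y|S) + ε (tightness part of Theorem 1). -/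
open MeasureTheory ProbabilityTheory Real

noncomputable section

/-- The probability mass function of a random variable `X` under the measure `μ`. -/
def pm {Ω : Type*} [MeasurableSpace Ω] (μ : Measure Ω) {𝒳 : Type*} (X : Ω → 𝒳) (x : 𝒳) : ℝ :=
  (μ (X ⁻¹' {x})).toReal

/-- Shannon entropy (base 2) of a finite-valued random variable. -/
def ent {Ω : Type*} [MeasurableSpace Ω] (μ : Measure Ω) {𝒳 : Type*} [Fintype 𝒳]
    (X : Ω → 𝒳) : ℝ :=
  -∑ x, pm μ X x * Real.logb 2 (pm μ X x)

/-- Conditional entropy `H(X|Y) = H(X,Y) - H(Y)` (base 2). -/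
def condEnt {Ω : Type*} [MeasurableSpace Ω] (μ : Measure Ω) {𝒳 𝒴 : Type*} [Fintype 𝒳]
    [Fintype 𝒴] (X : Ω → 𝒳) (Y : Ω → 𝒴) : ℝ :=
  ent μ (fun ω => (X ω, Y ω)) - ent μ Y

/-- Mutual information `I(X;Y) = H(X) + H(Y) - H(X,Y)` (base 2). -/
def mi {Ω : Type*} [MeasurableSpace Ω] (μ : Measure Ω) {𝒳 𝒴 : Type*} [Fintype 𝒳]
    [Fintype 𝒴] (X : Ω → 𝒳) (Y : Ω → 𝒴) : ℝ :=
  ent μ X + ent μ Y - ent μ (fun ω => (X ω, Y ω))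

/-- Conditional mutual information `I(X;Y|Z) = H(X|Z) + H(Y|Z) - H((X,Y)|Z)` (base 2). -/
def condMI {Ω : Type*} [MeasurableSpace Ω] (μ : Measure Ω) {𝒳 𝒴 𝒵 : Type*} [Fintype 𝒳]
    [Fintype 𝒴] [Fintype 𝒵] (X : Ω → 𝒳) (Y : Ω → 𝒴) (Z : Ω → 𝒵) : ℝ :=
  condEnt μ X Z + condEnt μ Y Z - condEnt μ (fun ω => (X ω, Y ω)) Z

section EntropyLemmas

variable {Ω : Type*} [MeasurableSpace Ω] {μ : Measure Ω} {α β : Type*}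

lemma pm_nonneg (X : Ω → α) (a : α) : 0 ≤ pm μ X a := ENNReal.toReal_nonneg

lemma ent_eq_sum_negMulLog_div [Fintype α] (X : Ω → α) :
    ent μ X = (∑ a, negMulLog (pm μ X a)) / log 2 := by
  simp only [ent, negMulLog, Real.logb, Finset.sum_div, ← Finset.sum_neg_distrib]
  exact Finset.sum_congr rfl fun a _ => by ring

lemma pm_congr_ae {X X' : Ω → α} (h : X =ᵐ[μ] X') (a : α) : pm μ X a = pm μ X' a := by
  unfold pm
  congr 1
  apply measure_congr
  filter_upwards [h] with ω hω
  change (X ω = a) = (X' ω = a)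
  rw [hω]

lemma ent_congr_ae [Fintype α] {X X' : Ω → α} (h : X =ᵐ[μ] X') : ent μ X = ent μ X' := by
  simp only [ent, pm_congr_ae h]

lemma pm_le_pm_comp [IsFiniteMeasure μ] {X : Ω → α} (f : α → β) (a : α) :
    pm μ X a ≤ pm μ (fun ω => f (X ω)) (f a) := by
  apply ENNReal.toReal_mono (measure_ne_top _ _)
  apply measure_mono
  intro ω hω
  simp only [Set.mem_preimage, Set.mem_singleton_iff] at hω ⊢
  rw [hω]

lemma mul_log_pm_comp_sub_nonneg [IsFiniteMeasure μ] {X : Ω → α} (f : α → β) (a : α) :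
    0 ≤ pm μ X a * (log (pm μ (fun ω => f (X ω)) (f a)) - log (pm μ X a)) := by
  rcases (pm_nonneg (μ := μ) X a).eq_or_lt with h | h
  · simp [← h]
  · exact mul_nonneg h.le (sub_nonneg.2 (log_le_log h (pm_le_pm_comp f a)))

variable [MeasurableSpace α] [MeasurableSingletonClass α]

lemma pm_eq_map {X : Ω → α} (hX : Measurable X) (a : α) :
    pm μ X a = (μ.map X {a}).toReal := by
  rw [pm, Measure.map_apply hX (measurableSet_singleton a)]

lemma ent_congr_map [Fintype α] {Ω' : Type*} [MeasurableSpace Ω'] {μ' : Measure Ω'}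
    {X : Ω → α} {X' : Ω' → α} (hX : Measurable X) (hX' : Measurable X')
    (h : μ.map X = μ'.map X') : ent μ X = ent μ' X' := by
  simp only [ent, pm_eq_map hX, pm_eq_map hX', h]

lemma ent_comp_congr_map [Finite α] [Fintype β] [MeasurableSpace β] [MeasurableSingletonClass β]
    {Ω' : Type*} [MeasurableSpace Ω'] {μ' : Measure Ω'} {X : Ω → α} {X' : Ω' → α}
    (hX : Measurable X) (hX' : Measurable X') (h : μ.map X = μ'.map X') (f : α → β) :
    ent μ (fun ω => f (X ω)) = ent μ' fun ω => f (X' ω) := by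
  have hf : Measurable f := .of_discrete
  refine ent_congr_map (hf.comp hX) (hf.comp hX') ?_
  have h := congrArg (Measure.map f) h
  rwa [Measure.map_map hf hX, Measure.map_map hf hX'] at h

variable [IsFiniteMeasure μ] [Fintype α]

lemma pm_comp [DecidableEq β] {X : Ω → α} (hX : Measurable X) (f : α → β) (b : β) :
    pm μ (fun ω => f (X ω)) b = ∑ a, if f a = b then pm μ X a else 0 := by
  rw [← Finset.sum_filter]
  have h := sum_measureReal_preimage_singleton (μ := μ) (f := X)
    (Finset.univ.filter fun a => f a = b) (fun a _ => hX (measurableSet_singleton a))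
  have h2 : (fun ω => f (X ω)) ⁻¹' {b} = X ⁻¹' ↑(Finset.univ.filter fun a => f a = b) := by
    ext ω; simp
  simp only [pm]
  rw [h2]
  exact h.symm

lemma ent_sub_ent_comp [Fintype β] {X : Ω → α} (hX : Measurable X) (f : α → β) :
    ent μ X - ent μ (fun ω => f (X ω)) =
      (∑ a, pm μ X a * (log (pm μ (fun ω => f (X ω)) (f a)) - log (pm μ X a))) / log 2 := by
  classical
  rw [ent_eq_sum_negMulLog_div, ent_eq_sum_negMulLog_div, ← sub_div]
  congr 1
  have h : ∑ b, negMulLog (pm μ (fun ω => f (X ω)) b) =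
      ∑ a, -(pm μ X a * log (pm μ (fun ω => f (X ω)) (f a))) := by
    have h1 : ∀ b, negMulLog (pm μ (fun ω => f (X ω)) b) =
        ∑ a, if f a = b then -(pm μ X a * log (pm μ (fun ω => f (X ω)) b)) else 0 := by
      intro b
      rw [negMulLog, neg_mul]
      nth_rewrite 1 [pm_comp hX f b]
      rw [Finset.sum_mul, ← Finset.sum_neg_distrib]
      exact Finset.sum_congr rfl fun a _ => by split_ifs <;> simp
    simp only [h1]
    rw [Finset.sum_comm]
    exact Finset.sum_congr rfl fun a _ => by simp
  rw [h, ← Finset.sum_sub_distrib]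
  exact Finset.sum_congr rfl fun a _ => by rw [negMulLog]; ring

/-- Applying a function does not increase entropy. -/
lemma ent_comp_le [Fintype β] {X : Ω → α} (hX : Measurable X) (f : α → β) :
    ent μ (fun ω => f (X ω)) ≤ ent μ X := by
  rw [← sub_nonneg, ent_sub_ent_comp hX f]
  exact div_nonneg (Finset.sum_nonneg fun a _ => mul_log_pm_comp_sub_nonneg f a)
    (log_nonneg (by norm_num))

lemma pm_comp_eq_of_ent_eq [Fintype β] {X : Ω → α} (hX : Measurable X) (f : α → β)
    (h : ent μ (fun ω => f (X ω)) = ent μ X) {a : α} (ha : pm μ X a ≠ 0) :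
    pm μ (fun ω => f (X ω)) (f a) = pm μ X a := by
  have h0 := ent_sub_ent_comp (μ := μ) hX f
  rw [h, sub_self, eq_comm, div_eq_zero_iff, or_iff_left (log_pos (by norm_num)).ne',
    Finset.sum_eq_zero_iff_of_nonneg fun a _ => mul_log_pm_comp_sub_nonneg f a] at h0
  have h1 := (mul_eq_zero.1 (h0 a (Finset.mem_univ a))).resolve_left ha
  have hpos : 0 < pm μ X a := lt_of_le_of_ne (pm_nonneg X a) ha.symm
  exact log_injOn_pos (hpos.trans_le (pm_le_pm_comp f a)) hpos (sub_eq_zero.1 h1)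

/-- A variable with zero conditional entropy given `Y` is almost surely a function of `Y`. -/
lemma exists_ae_eq_of_condEnt_eq_zero [Nonempty α] [Fintype β] [MeasurableSpace β]
    [MeasurableSingletonClass β] {S : Ω → α} {Y : Ω → β} (hS : Measurable S) (hY : Measurable Y)
    (h : condEnt μ S Y = 0) :
    ∃ g : β → α, ∀ᵐ p ∂(μ.map fun ω => (S ω, Y ω)), p.1 = g p.2 := by
  classical
  set X : Ω → α × β := fun ω => (S ω, Y ω) with hXdef
  have hX : Measurable X := hS.prodMk hY
  have heq : ∀ {p : α × β}, pm μ X p ≠ 0 → pm μ Y p.2 = pm μ X p := fun {p} hp =>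
    pm_comp_eq_of_ent_eq hX Prod.snd (sub_eq_zero.1 h).symm hp
  have huniq : ∀ s t y, pm μ X (s, y) ≠ 0 → pm μ X (t, y) ≠ 0 → s = t := by
    intro s t y hs ht
    by_contra hst
    have h1 := heq hs
    have h2 := heq ht
    have h3 : ∑ p ∈ {(s, y), (t, y)}, pm μ X p ≤ pm μ Y y := by
      rw [show Y = fun ω => (X ω).2 from rfl, pm_comp hX Prod.snd y, ← Finset.sum_filter]
      apply Finset.sum_le_sum_of_subset_of_nonneg
      · intro p hp
        simp only [Finset.mem_insert, Finset.mem_singleton] at hp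
        rcases hp with rfl | rfl <;> simp
      · exact fun p _ _ => pm_nonneg X p
    rw [Finset.sum_pair (by simp [hst])] at h3
    have h4 := lt_of_le_of_ne (pm_nonneg (μ := μ) X (s, y)) hs.symm
    simp only at h1 h2
    linarith
  refine ⟨fun y => Classical.epsilon fun s => pm μ X (s, y) ≠ 0, ?_⟩
  rw [ae_iff_of_countable]
  rintro ⟨s, y⟩ hp
  have hp' : pm μ X (s, y) ≠ 0 := by
    rw [pm_eq_map hX]
    exact ENNReal.toReal_ne_zero.2 ⟨hp, measure_ne_top _ _⟩
  exact huniq _ _ _ hp' (Classical.epsilon_spec (p := fun s => pm μ X (s, y) ≠ 0) ⟨s, hp'⟩)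

end EntropyLemmas

section WeightedMeasure

variable {α : Type*} [Fintype α] [MeasurableSpace α]

/-- The measure on a finite type with prescribed point masses. -/
def weightedMeasure (w : α → ℝ) : Measure α :=
  ∑ a, ENNReal.ofReal (w a) • Measure.dirac a

lemma weightedMeasure_singleton [MeasurableSingletonClass α] (w : α → ℝ) (a : α) :
    weightedMeasure w {a} = ENNReal.ofReal (w a) := by
  classical
  simp [weightedMeasure, Measure.finsetSum_apply, Set.indicator_apply]

lemma isProbabilityMeasure_weightedMeasure {w : α → ℝ} (hw : ∀ a, 0 ≤ w a) (h1 : ∑ a, w a = 1) :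
    IsProbabilityMeasure (weightedMeasure w) := by
  constructor
  simp [weightedMeasure, Measure.finsetSum_apply]
  rw [← ENNReal.ofReal_sum_of_nonneg fun a _ => hw a, h1, ENNReal.ofReal_one]

lemma pm_weightedMeasure_id [MeasurableSingletonClass α] {w : α → ℝ} (hw : ∀ a, 0 ≤ w a) (a : α) :
    pm (weightedMeasure w) id a = w a := by
  rw [pm, Set.preimage_id, weightedMeasure_singleton, ENNReal.toReal_ofReal (hw a)]

lemma pm_weightedMeasure [MeasurableSingletonClass α] {w : α → ℝ} (hw : ∀ a, 0 ≤ w a)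
    [IsFiniteMeasure (weightedMeasure w)] {β : Type*} [DecidableEq β] (f : α → β) (b : β) :
    pm (weightedMeasure w) f b = ∑ a, if f a = b then w a else 0 := by
  have h := pm_comp (μ := weightedMeasure w) measurable_id f b
  simp only [pm_weightedMeasure_id hw] at h
  exact h

end WeightedMeasure

lemma sum_negMulLog_mul {α β : Type*} [Fintype α] [Fintype β] {p : α → ℝ} {q : β → ℝ}
    (hp : ∑ a, p a = 1) (hq : ∑ b, q b = 1) :
    ∑ x : α × β, negMulLog (p x.1 * q x.2) = ∑ a, negMulLog (p a) + ∑ b, negMulLog (q b) := by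
  simp only [Fintype.sum_prod_type, negMulLog_mul, Finset.sum_add_distrib, ← Finset.sum_mul,
    ← Finset.mul_sum, hp, hq, one_mul]

lemma sum_prod_apply {α β : Type*} [Fintype α] [Fintype β] [DecidableEq α] {q : α → β → ℝ}
    (hq : ∀ a, ∑ b, q a b = 1) : ∑ f : α → β, ∏ a, q a (f a) = 1 := by
  classical
  rw [← Fintype.piFinset_univ, ← Finset.prod_univ_sum]
  simp [hq]

lemma sum_prod_apply_of_apply_eq {α β : Type*} [Fintype α] [Fintype β] [DecidableEq α]
    [DecidableEq β] {q : α → β → ℝ} (hq : ∀ a, ∑ b, q a b = 1) (s : α) (y : β) :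
    ∑ f : α → β, (if f s = y then ∏ a, q a (f a) else 0) = q s y := by
  have h : ∀ f : α → β, (if f s = y then ∏ a, q a (f a) else 0) =
      ∏ a, if a = s then (if f a = y then q a (f a) else 0) else q a (f a) := by
    intro f
    split_ifs with h
    · refine Finset.prod_congr rfl fun a _ => ?_
      split_ifs with h1 h2
      · rfl
      · exact absurd (h1 ▸ h) h2
      · rfl
    · exact (Finset.prod_eq_zero (Finset.mem_univ s) (by simp [h])).symm
  simp only [h]
  rw [← Fintype.piFinset_univ, ← Finset.prod_univ_sum _
    (fun a b => if a = s then (if b = y then q a b else 0) else q a b)]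
  rw [Finset.prod_eq_single s]
  · simp
  · intro a _ ha
    simp [ha, hq]
  · simp

/-- Every weight on a product of finite types disintegrates along its first marginal. -/
lemma exists_conditional_weights {α β : Type*} [Fintype α] [Fintype β] [Nonempty β]
    {r : α → β → ℝ} (hr : ∀ a b, 0 ≤ r a b) :
    ∃ q : α → β → ℝ, (∀ a b, 0 ≤ q a b) ∧ (∀ a, ∑ b, q a b = 1) ∧
      ∀ a b, r a b = (∑ b', r a b') * q a b := by
  classical
  obtain ⟨b₀⟩ := ‹Nonempty β›
  refine ⟨fun a b => if ∑ b', r a b' = 0 then (if b = b₀ then 1 else 0)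
    else r a b / ∑ b', r a b', ?_, ?_, ?_⟩
  · intro a b
    have := Finset.sum_nonneg fun b (_ : b ∈ Finset.univ) => hr a b
    dsimp only
    split_ifs <;> first | positivity | exact div_nonneg (hr a b) this
  · intro a
    by_cases h : ∑ b', r a b' = 0
    · simp [h]
    · simp [h, ← Finset.sum_div]
  · intro a b
    by_cases h : ∑ b', r a b' = 0
    · rw [h, zero_mul]
      exact (Finset.sum_eq_zero_iff_of_nonneg fun b _ => hr a b).1 h b (Finset.mem_univ b)
    · simp only [h, if_false]
      field_simp

section ErasureChannel

variable {α γ : Type*}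

/-- Weights of independent variables with weights `p`, `Q` and a Bernoulli variable of
parameter `c`. -/
def erasureWeight (p : α → ℝ) (Q : γ → ℝ) (c : ℝ) (ω : α × γ × Bool) : ℝ :=
  p ω.1 * (Q ω.2.1 * if ω.2.2 then c else 1 - c)

/-- Keep the second coordinate, and erase the first one unless the third is `true`. -/
def erasure (ω : α × γ × Bool) : γ × Option α := (ω.2.1, if ω.2.2 then some ω.1 else none)

variable {p : α → ℝ} {Q : γ → ℝ} {c : ℝ}

lemma erasureWeight_nonneg (hp : ∀ a, 0 ≤ p a) (hQ : ∀ x, 0 ≤ Q x) (hc0 : 0 ≤ c) (hc1 : c ≤ 1)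
    (ω : α × γ × Bool) : 0 ≤ erasureWeight p Q c ω := by
  unfold erasureWeight
  have := hp ω.1
  have := hQ ω.2.1
  have := sub_nonneg.2 hc1
  split_ifs <;> positivity

variable [Fintype α] [Fintype γ]

lemma sum_erasureWeight (hp : ∑ a, p a = 1) (hQ : ∑ x, Q x = 1) :
    ∑ ω, erasureWeight p Q c ω = 1 := by
  simp [erasureWeight, Fintype.sum_prod_type, ← Finset.mul_sum, ← mul_add, hQ, hp]

variable [MeasurableSpace α] [MeasurableSingletonClass α] [MeasurableSpace γ]
  [MeasurableSingletonClass γ]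

lemma ent_erasure (hp0 : ∀ a, 0 ≤ p a) (hQ0 : ∀ x, 0 ≤ Q x) (hp : ∑ a, p a = 1)
    (hQ : ∑ x, Q x = 1) (hc0 : 0 ≤ c) (hc1 : c ≤ 1) :
    ent (weightedMeasure (erasureWeight p Q c)) erasure =
      ent (weightedMeasure (erasureWeight p Q c)) id -
        (1 - c) * ((∑ a, negMulLog (p a)) / log 2) := by
  classical
  have hw := erasureWeight_nonneg (p := p) (Q := Q) hp0 hQ0 hc0 hc1
  have := isProbabilityMeasure_weightedMeasure hw (sum_erasureWeight hp hQ)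
  have hB : ∑ j : Bool, (if j then c else 1 - c) = 1 := by simp
  have hid : ∑ ω, negMulLog (erasureWeight p Q c ω) =
      ∑ a, negMulLog (p a) + (∑ x, negMulLog (Q x) + (negMulLog c + negMulLog (1 - c))) := by
    have h1 : ∑ x : γ × Bool, Q x.1 * (if x.2 then c else 1 - c) = 1 := by
      simp [Fintype.sum_prod_type, ← mul_add, hQ]
    rw [show (negMulLog c + negMulLog (1 - c)) =
      ∑ j : Bool, negMulLog (if j then c else 1 - c) by simp,
      ← sum_negMulLog_mul hQ hB, ← sum_negMulLog_mul hp h1]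
    rfl
  have hE : ∑ o : Option α, (o.elim (1 - c) fun a => c * p a) = 1 := by
    simp [Fintype.sum_option, ← Finset.mul_sum, hp]
  have hpm : ∀ u : γ × Option α, pm (weightedMeasure (erasureWeight p Q c)) erasure u =
      Q u.1 * u.2.elim (1 - c) fun a => c * p a := by
    rintro ⟨x, _ | a⟩ <;> rw [pm_weightedMeasure hw] <;>
      simp only [erasure, erasureWeight, Fintype.sum_prod_type, Fintype.sum_bool, Prod.mk.injEq]
    · simp only [if_true, if_false, Bool.false_eq_true, reduceCtorEq, and_false, and_true, zero_add,
        Finset.sum_ite_eq', Finset.mem_univ, ← Finset.sum_mul, hp, Option.elim, one_mul]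
    · simp only [if_true, if_false, Bool.false_eq_true, reduceCtorEq, and_false, add_zero,
        Option.some.injEq, ite_and, Finset.sum_ite_eq', Finset.mem_univ, Option.elim]
      ring
  have hU : ∑ u : γ × Option α, negMulLog (Q u.1 * u.2.elim (1 - c) fun a => c * p a) =
      ∑ x, negMulLog (Q x) +
        (negMulLog (1 - c) + (negMulLog c + c * ∑ a, negMulLog (p a))) := by
    rw [sum_negMulLog_mul hQ hE, Fintype.sum_option]
    simp only [Option.elim, negMulLog_mul, Finset.sum_add_distrib, ← Finset.sum_mul,
      ← Finset.mul_sum, hp, one_mul]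
  rw [ent_eq_sum_negMulLog_div, ent_eq_sum_negMulLog_div]
  simp only [hpm, pm_weightedMeasure_id hw, hid, hU]
  ring

end ErasureChannel

section DeterministicPrivateData

variable {Ω α β γ : Type*} [MeasurableSpace Ω] {μ : Measure Ω} [IsFiniteMeasure μ]
  [Fintype α] [MeasurableSpace α] [MeasurableSingletonClass α]
  [Fintype β] [MeasurableSpace β] [MeasurableSingletonClass β]
  [Fintype γ] [MeasurableSpace γ] [MeasurableSingletonClass γ]
  {S : Ω → α} {Y : Ω → β} {V : Ω → γ}

lemma mi_le_of_ae_eq (hY : Measurable Y) (hS : Measurable S) (hV : Measurable V) {g : β → α}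
    (hg : ∀ᵐ ω ∂μ, S ω = g (Y ω)) : mi μ V Y ≤ condEnt μ Y S + mi μ V S := by
  have h1 : ent μ Y ≤ ent μ fun ω => (Y ω, S ω) := ent_comp_le (hY.prodMk hS) Prod.fst
  have h2 : ent μ (fun ω => (V ω, S ω)) = ent μ fun ω => (V ω, g (Y ω)) :=
    ent_congr_ae (by filter_upwards [hg] with ω hω; rw [hω])
  have h3 : ent μ (fun ω => (V ω, g (Y ω))) ≤ ent μ fun ω => (V ω, Y ω) :=
    ent_comp_le (hV.prodMk hY) fun x => (x.1, g x.2)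
  unfold mi condEnt
  linarith

lemma mi_eq_of_ae_eq (hY : Measurable Y) (hS : Measurable S) (hV : Measurable V) {g : β → α}
    (hg : ∀ᵐ ω ∂μ, S ω = g (Y ω)) {f : γ × α → β} (hf : ∀ ω, Y ω = f (V ω, S ω)) :
    mi μ V Y = condEnt μ Y S + mi μ V S := by
  refine (mi_le_of_ae_eq hY hS hV hg).antisymm ?_
  have h1 : ent μ (fun ω => (Y ω, S ω)) = ent μ fun ω => (Y ω, g (Y ω)) :=
    ent_congr_ae (by filter_upwards [hg] with ω hω; rw [hω])
  have h2 : ent μ (fun ω => (Y ω, g (Y ω))) ≤ ent μ Y := ent_comp_le hY fun y => (y, g y)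
  have h3 : ent μ (fun ω => (V ω, Y ω)) ≤ ent μ fun ω => (V ω, S ω) := by
    simp only [hf]
    exact ent_comp_le (hV.prodMk hS) fun x => (x.1, f x)
  unfold mi condEnt
  linarith

end DeterministicPrivateData

/-- tightness part of Theorem 1. If `H(S|Y) = 0` and `0 ≤ ε < I(S;Y)`,
there is a probability space carrying `(S',Y')` distributed as `(S,Y)` on which some
finite-valued `U` achieves `I(U;S') ≤ ε` and `I(U;Y') = H(Y|S) + ε`, and moreover every
finite-valued `U` with `I(U;S') ≤ ε` satisfies `I(U;Y') ≤ H(Y|S) + ε`. -/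
theorem optimal_tradeoff_of_detS
    {Ω : Type*} [MeasurableSpace Ω] (μ : Measure Ω) [IsProbabilityMeasure μ]
    {𝒮 𝒴 : Type*}
    [Fintype 𝒮] [Nonempty 𝒮] [MeasurableSpace 𝒮] [MeasurableSingletonClass 𝒮]
    [Fintype 𝒴] [Nonempty 𝒴] [MeasurableSpace 𝒴] [MeasurableSingletonClass 𝒴]
    (S : Ω → 𝒮) (Y : Ω → 𝒴) (hS : Measurable S) (hY : Measurable Y)
    (hdet : condEnt μ S Y = 0)
    (ε : ℝ) (hε0 : 0 ≤ ε) (hε : ε < mi μ S Y) :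
    ∃ (Ω' : Type) (mΩ' : MeasurableSpace Ω'), haveI := mΩ';
    ∃ (μ' : Measure Ω'), IsProbabilityMeasure μ' ∧
    ∃ (S' : Ω' → 𝒮) (Y' : Ω' → 𝒴), Measurable S' ∧ Measurable Y' ∧
      Measure.map (fun ω => (S' ω, Y' ω)) μ' = Measure.map (fun ω => (S ω, Y ω)) μ ∧
      (∃ (𝒰 : Type) (iF : Fintype 𝒰) (iN : Nonempty 𝒰) (iM : MeasurableSpace 𝒰),
        haveI := iF; haveI := iM;
       ∃ (iMS : MeasurableSingletonClass 𝒰) (U : Ω' → 𝒰), Measurable U ∧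
        mi μ' U S' ≤ ε ∧ mi μ' U Y' = condEnt μ Y S + ε) ∧
      (∀ (𝒱 : Type) [Fintype 𝒱] [Nonempty 𝒱]
          [MeasurableSpace 𝒱] [MeasurableSingletonClass 𝒱] (V : Ω' → 𝒱),
        Measurable V → mi μ' V S' ≤ ε → mi μ' V Y' ≤ condEnt μ Y S + ε) := by
  classical
  set X : Ω → 𝒮 × 𝒴 := fun ω => (S ω, Y ω) with hXdef
  have hX : Measurable X := hS.prodMk hY
  obtain ⟨g, hg⟩ := exists_ae_eq_of_condEnt_eq_zero hS hY hdet
  have hmi : mi μ S Y = ent μ S := by unfold mi; unfold condEnt at hdet; linarith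
  rw [hmi] at hε
  have hHS : 0 < ent μ S := hε0.trans_lt hε
  set c := ε / ent μ S with hc
  have hc0 : 0 ≤ c := div_nonneg hε0 hHS.le
  have hc1 : c ≤ 1 := (div_le_one hHS).2 hε.le
  obtain ⟨n, ⟨e⟩⟩ := Finite.exists_equiv_fin 𝒮
  obtain ⟨m, ⟨k⟩⟩ := Finite.exists_equiv_fin 𝒴
  have : Nonempty (Fin m) := k.nonempty_congr.1 inferInstance
  set r : Fin n → Fin m → ℝ := fun i j => pm μ X (e.symm i, k.symm j)
  obtain ⟨q, hq0, hq1, hrq⟩ := exists_conditional_weights (r := r) fun i j => pm_nonneg _ _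
  have hp : ∀ i, ∑ j, r i j = pm μ S (e.symm i) := by
    intro i
    rw [show S = fun ω => (X ω).1 from rfl, pm_comp hX Prod.fst, Fintype.sum_prod_type,
      Finset.sum_eq_single (e.symm i) (fun s _ hs => by simp [hs]) (by simp)]
    simp only [if_true]
    exact Equiv.sum_comp k.symm fun y => pm μ X (e.symm i, y)
  simp only [hp] at hrq
  set p : Fin n → ℝ := fun i => pm μ S (e.symm i)
  have hp0 : ∀ i, 0 ≤ p i := fun i => pm_nonneg _ _
  have hp1 : ∑ i, p i = 1 := by
    rw [Equiv.sum_comp e.symm fun s => pm μ S s]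
    have h := pm_comp (μ := μ) hS (fun _ => ()) ()
    simp only [if_true] at h
    rw [← h]
    simp [pm]
  have hpS : (∑ i, negMulLog (p i)) / log 2 = ent μ S := by
    rw [ent_eq_sum_negMulLog_div, Equiv.sum_comp e.symm fun s => negMulLog (pm μ S s)]
  set Q : (Fin n → Fin m) → ℝ := fun f => ∏ i, q i (f i) with hQ
  have hQ0 : ∀ f, 0 ≤ Q f := fun f => Finset.prod_nonneg fun i _ => hq0 i _
  have hQ1 : ∑ f, Q f = 1 := sum_prod_apply hq1
  set w := erasureWeight p Q c with hwdef
  have hw : ∀ ω, 0 ≤ w ω := erasureWeight_nonneg hp0 hQ0 hc0 hc1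
  have hprob : IsProbabilityMeasure (weightedMeasure w) :=
    isProbabilityMeasure_weightedMeasure hw (sum_erasureWeight hp1 hQ1)
  let S' : Fin n × (Fin n → Fin m) × Bool → 𝒮 := fun ω => e.symm ω.1
  let Y' : Fin n × (Fin n → Fin m) × Bool → 𝒴 := fun ω => k.symm (ω.2.1 ω.1)
  have hS' : Measurable S' := .of_discrete
  have hY' : Measurable Y' := .of_discrete
  have hX' : Measurable fun ω => (S' ω, Y' ω) := hS'.prodMk hY'
  have hmap : (weightedMeasure w).map (fun ω => (S' ω, Y' ω)) = μ.map X := by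
    have := Measure.isProbabilityMeasure_map (μ := μ) hX.aemeasurable
    have := Measure.isProbabilityMeasure_map (μ := weightedMeasure w) hX'.aemeasurable
    refine Measure.ext_of_singleton fun x => ?_
    rw [← ENNReal.toReal_eq_toReal_iff' (measure_ne_top _ _) (measure_ne_top _ _),
      ← pm_eq_map hX', ← pm_eq_map hX]
    obtain ⟨s, y⟩ := x
    obtain ⟨i, rfl⟩ := e.symm.surjective s
    obtain ⟨j, rfl⟩ := k.symm.surjective y
    rw [pm_weightedMeasure hw]
    change _ = r i j
    rw [hrq, ← sum_prod_apply_of_apply_eq hq1 i j]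
    simp only [S', Y', hwdef, erasureWeight, Prod.mk.injEq, EmbeddingLike.apply_eq_iff_eq,
      Fintype.sum_prod_type, Fintype.sum_bool, if_true, if_false, Bool.false_eq_true]
    rw [Finset.sum_eq_single i (fun a _ ha => by simp [ha]) (by simp), Finset.mul_sum]
    refine Finset.sum_congr rfl fun f _ => ?_
    simp only [true_and, hQ]
    split_ifs <;> ring
  have hentS : ent (weightedMeasure w) S' = ent μ S :=
    ent_comp_congr_map hX' hX hmap Prod.fst
  have hcond : condEnt (weightedMeasure w) Y' S' = condEnt μ Y S := by
    unfold condEnt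
    rw [hentS]
    congr 1
    exact ent_comp_congr_map hX' hX hmap Prod.swap
  have hg' : ∀ᵐ ω ∂(weightedMeasure w), S' ω = g (Y' ω) := by
    rw [← hXdef, ← hmap] at hg
    exact ae_of_ae_map hX'.aemeasurable hg
  refine ⟨_, inferInstance, weightedMeasure w, hprob, S', Y', hS', hY', hmap, ?_, ?_⟩
  · let iM : MeasurableSpace ((Fin n → Fin m) × Option (Fin n)) := ⊤
    have iMS : MeasurableSingletonClass ((Fin n → Fin m) × Option (Fin n)) := ⟨fun _ => trivial⟩
    have hU : Measurable[_, iM] (erasure : Fin n × (Fin n → Fin m) × Bool → _) := .of_discrete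
    have hUS : ent (weightedMeasure w) (fun ω => (erasure ω, S' ω)) =
        ent (weightedMeasure w) id := by
      refine le_antisymm (ent_comp_le measurable_id fun x => (erasure x, S' x)) ?_
      have hid : (id : Fin n × (Fin n → Fin m) × Bool → _) =
          fun ω => (e (S' ω), (erasure ω).1, (erasure ω).2.isSome) := by
        ext1 ω
        obtain ⟨i, f, _ | _⟩ := ω <;> simp [erasure, S']
      nth_rewrite 1 [hid]
      exact ent_comp_le (hU.prodMk hS') fun x => (e x.2, x.1.1, x.1.2.isSome)
    have hUne : Nonempty ((Fin n → Fin m) × Option (Fin n)) := ⟨fun _ => Classical.arbitrary _, none⟩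
    have hmiU : mi (weightedMeasure w) erasure S' = ε := by
      rw [mi, hUS, hentS, ent_erasure hp0 hQ0 hp1 hQ1 hc0 hc1, hpS, hc]
      field_simp
      ring
    refine ⟨_, inferInstance, hUne, iM, iMS, erasure, hU,
      hmiU.le, ?_⟩
    rw [mi_eq_of_ae_eq hY' hS' hU hg' (f := fun x => k.symm (x.1.1 (e x.2)))
      (fun ω => by simp [Y', S', erasure]), hcond, hmiU]
  · intro 𝒱 _ _ _ _ V hV hVS
    exact (mi_le_of_ae_eq hY' hS' hV hg').trans (by rw [hcond]; gcongr)
end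
end

section
/- Let S, Y be random variables on a probability space with values in nonempty finite sets and let 0 ≤ ε < I(S;Y). If for every probability space carrying random variables S', Y' with the same joint distribution as (S,Y) and every finite-valued random variable U with I(U;S') ≤ ε one has I(U;Y') ≤ H(Y) − H(S) + ε (i.e., the lower bound L_h^1(ε) is tight), then H(S|Y) = 0. -/
open MeasureTheory ProbabilityTheory Real

noncomputable section

/-- The image of a mass function `w` under a map `X` between finite types. -/
def pushMass {A B : Type*} [Fintype A] (w : A → ℝ) (X : A → B) (b : B) : ℝ := by
  classical exact ∑ a, if X a = b then w a else 0

/-- The entropy in nats of a mass function on a finite type. -/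
def massEnt {A : Type*} [Fintype A] (w : A → ℝ) : ℝ := ∑ a, negMulLog (w a)

section MassFunctions

variable {A B C : Type*} [Fintype A]

theorem pushMass_apply [DecidableEq B] (w : A → ℝ) (X : A → B) (b : B) :
    pushMass w X b = ∑ a, if X a = b then w a else 0 := by
  unfold pushMass
  congr!

theorem pushMass_apply_of_injective (w : A → ℝ) {X : A → B} (hX : X.Injective) (a : A) :
    pushMass w X (X a) = w a := by
  classical
  simp [pushMass_apply, hX.eq_iff]

theorem le_pushMass {w : A → ℝ} (hw : ∀ a, 0 ≤ w a) (X : A → B) (a : A) :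
    w a ≤ pushMass w X (X a) := by
  classical
  rw [pushMass_apply]
  refine le_trans (by simp) (Finset.single_le_sum
    (f := fun a' => if X a' = X a then w a' else 0) (fun a' _ => ?_) (Finset.mem_univ a))
  split_ifs <;> simp [hw]

theorem add_le_pushMass {w : A → ℝ} (hw : ∀ a, 0 ≤ w a) {X : A → B} {a b : A} (hab : a ≠ b)
    (h : X a = X b) : w a + w b ≤ pushMass w X (X a) := by
  classical
  rw [pushMass_apply]
  have := Finset.sum_le_sum_of_subset_of_nonneg (Finset.subset_univ ({a, b} : Finset A))
    (f := fun a' => if X a' = X a then w a' else 0)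
    (fun a' _ _ => by split_ifs <;> simp [hw])
  simpa [Finset.sum_pair hab, h] using this

theorem mul_log_pushMass_sub_log_nonneg {w : A → ℝ} (hw : ∀ a, 0 ≤ w a) (X : A → B) (a : A) :
    0 ≤ w a * (log (pushMass w X (X a)) - log (w a)) := by
  rcases (hw a).eq_or_lt with h | h
  · simp [← h]
  · exact mul_nonneg h.le (sub_nonneg.2 (log_le_log h (le_pushMass hw X a)))

variable [Fintype B]

theorem sum_pushMass (w : A → ℝ) (X : A → B) : ∑ b, pushMass w X b = ∑ a, w a := by
  classical
  simp only [pushMass_apply]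
  rw [Finset.sum_comm]
  simp

theorem pushMass_pushMass (w : A → ℝ) (X : A → B) (g : B → C) :
    pushMass (pushMass w X) g = pushMass w (g ∘ X) := by
  classical
  ext c
  simp only [pushMass_apply, Function.comp_apply, ← Finset.sum_filter]
  rw [← Finset.sum_fiberwise_of_maps_to (s := {a | g (X a) = c}) (t := {b | g b = c}) (g := X)
    (by simp)]
  refine Finset.sum_congr rfl fun b hb => Finset.sum_congr ?_ fun _ _ => rfl
  ext a
  simp only [Finset.mem_filter, Finset.mem_univ, true_and] at hb ⊢
  constructor
  · rintro rfl
    exact ⟨hb, rfl⟩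
  · exact fun h => h.2

/-- The entropy lost under a map, as a sum of pointwise losses. -/
theorem massEnt_sub_massEnt_pushMass (w : A → ℝ) (X : A → B) :
    massEnt w - massEnt (pushMass w X) =
      ∑ a, w a * (log (pushMass w X (X a)) - log (w a)) := by
  classical
  have h : massEnt (pushMass w X) = -∑ a, w a * log (pushMass w X (X a)) := by
    unfold massEnt negMulLog
    simp_rw [neg_mul, Finset.sum_neg_distrib]
    congr 1
    conv_lhs =>
      enter [2, b]
      rw [pushMass_apply, Finset.sum_mul]
    rw [Finset.sum_comm]
    refine Finset.sum_congr rfl fun a _ => ?_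
    simp [← pushMass_apply]
  rw [h]
  simp only [massEnt, negMulLog, mul_sub, Finset.sum_sub_distrib, neg_mul, Finset.sum_neg_distrib]
  ring

theorem massEnt_pushMass_le {w : A → ℝ} (hw : ∀ a, 0 ≤ w a) (X : A → B) :
    massEnt (pushMass w X) ≤ massEnt w := by
  rw [← sub_nonneg, massEnt_sub_massEnt_pushMass]
  exact Finset.sum_nonneg fun a _ => mul_log_pushMass_sub_log_nonneg hw X a

/-- Merging two atoms of positive mass strictly decreases entropy. -/
theorem massEnt_pushMass_lt {w : A → ℝ} (hw : ∀ a, 0 ≤ w a) {X : A → B} {a b : A} (hab : a ≠ b)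
    (h : X a = X b) (ha : 0 < w a) (hb : 0 < w b) : massEnt (pushMass w X) < massEnt w := by
  rw [← sub_pos, massEnt_sub_massEnt_pushMass]
  refine Finset.sum_pos' (fun a _ => mul_log_pushMass_sub_log_nonneg hw X a)
    ⟨a, Finset.mem_univ a, mul_pos ha (sub_pos.2 (log_lt_log ha ?_))⟩
  linarith [add_le_pushMass hw hab h]

/-- Entropy is preserved by a map that is injective on the support. -/
theorem massEnt_pushMass_eq {w : A → ℝ} {X : A → B}
    (h : ∀ a b, X a = X b → w a ≠ 0 → w b ≠ 0 → a = b) :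
    massEnt (pushMass w X) = massEnt w := by
  classical
  refine (sub_eq_zero.1 ?_).symm
  rw [massEnt_sub_massEnt_pushMass]
  refine Finset.sum_eq_zero fun a _ => ?_
  by_cases ha : w a = 0
  · simp [ha]
  · have : pushMass w X (X a) = w a := by
      rw [pushMass_apply, Finset.sum_eq_single a] <;> simp only [Finset.mem_univ, if_true,
        not_true_eq_false, false_imp_iff, forall_const]
      intro b hb
      by_contra hne
      simp only [ite_eq_right_iff, Classical.not_imp] at hne
      exact hb (h b a hne.1 hne.2 ha)
    simp [this]

theorem massEnt_pushMass_of_injective (w : A → ℝ) {X : A → B} (hX : X.Injective) :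
    massEnt (pushMass w X) = massEnt w :=
  massEnt_pushMass_eq fun _ _ h _ _ => hX h

theorem massEnt_prod {p : A → ℝ} {q : B → ℝ} (hp : ∑ a, p a = 1) (hq : ∑ b, q b = 1) :
    massEnt (fun x : A × B => p x.1 * q x.2) = massEnt p + massEnt q := by
  simp only [massEnt, Fintype.sum_prod_type, negMulLog_mul, Finset.sum_add_distrib,
    ← Finset.mul_sum, ← Finset.sum_mul, hp, hq, one_mul]

end MassFunctions

section RandomVariables

variable {Ω : Type*} [MeasurableSpace Ω] (μ : Measure Ω)

theorem ent_eq_massEnt {𝒳 : Type*} [Fintype 𝒳] (X : Ω → 𝒳) :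
    ent μ X = massEnt (pm μ X) / log 2 := by
  simp only [ent, massEnt, negMulLog, logb, Finset.sum_div, ← Finset.sum_neg_distrib]
  exact Finset.sum_congr rfl fun _ _ => by ring

theorem pm_comp_s8 [IsFiniteMeasure μ] {𝒳 𝒵 : Type*} [Fintype 𝒳] {X : Ω → 𝒳}
    (hX : ∀ x, MeasurableSet (X ⁻¹' {x})) (g : 𝒳 → 𝒵) :
    pm μ (fun ω => g (X ω)) = pushMass (pm μ X) g := by
  classical
  ext z
  have hset : (fun ω => g (X ω)) ⁻¹' {z} =
      ⋃ x ∈ (Finset.univ.filter fun x => g x = z), X ⁻¹' {x} := by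
    ext ω
    simp
  rw [pushMass_apply, ← Finset.sum_filter, pm, hset,
    measure_biUnion_finset _ fun x _ => hX x,
    ENNReal.toReal_sum fun x _ => measure_ne_top μ _]
  · rfl
  · intro x _ y _ hxy
    exact Disjoint.preimage X (Set.disjoint_singleton.2 hxy)

theorem sum_pm [IsProbabilityMeasure μ] {𝒳 : Type*} [Fintype 𝒳] {X : Ω → 𝒳}
    (hX : ∀ x, MeasurableSet (X ⁻¹' {x})) : ∑ x, pm μ X x = 1 := by
  have h := congrFun (pm_comp_s8 μ hX fun _ => ()) ()
  simpa [pm, pushMass] using h.symm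

/-- Every mass function of total mass one is the mass function of a probability measure. -/
theorem exists_measure_pm_id {A : Type*} [Fintype A] [MeasurableSpace A]
    [MeasurableSingletonClass A] {w : A → ℝ} (hw : ∀ a, 0 ≤ w a) (hw1 : ∑ a, w a = 1) :
    ∃ ν : Measure A, IsProbabilityMeasure ν ∧ pm ν id = w := by
  have h1 : ∑ a, ENNReal.ofReal (w a) = 1 := by
    rw [← ENNReal.ofReal_sum_of_nonneg fun a _ => hw a, hw1, ENNReal.ofReal_one]
  refine ⟨(PMF.ofFintype (fun a => ENNReal.ofReal (w a)) h1).toMeasure, inferInstance, ?_⟩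
  ext a
  rw [pm, Set.preimage_id, PMF.toMeasure_apply_singleton _ _ (measurableSet_singleton a)]
  simp [hw a]

end RandomVariables

/-- Transport of mass functions along an enumeration of the sample space. -/
theorem pm_comp_symm {A B 𝒳 : Type*} [Fintype A] [Fintype B] [MeasurableSpace B]
    [MeasurableSingletonClass B] {ν : Measure B} [IsFiniteMeasure ν] {w : A → ℝ} (e : A ≃ B)
    (hν : pm ν id = pushMass w e) (X : A → 𝒳) :
    pm ν (fun b => X (e.symm b)) = pushMass w X := by
  have h := pm_comp_s8 ν (X := id) (fun _ => measurableSet_singleton _) fun b => X (e.symm b)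
  rw [hν, pushMass_pushMass] at h
  simpa [Function.comp_def] using h

/-- The law of a random variable on a finite type is determined by its mass function. -/
theorem map_eq_map_of_pm_eq {Ω Ω' 𝒳 : Type*} [MeasurableSpace Ω] [MeasurableSpace Ω'] [Fintype 𝒳]
    [MeasurableSpace 𝒳] [MeasurableSingletonClass 𝒳] {μ : Measure Ω} {μ' : Measure Ω'}
    [IsFiniteMeasure μ] [IsFiniteMeasure μ'] {X : Ω → 𝒳} {X' : Ω' → 𝒳}
    (hX : Measurable X) (hX' : Measurable X') (h : pm μ' X' = pm μ X) :
    Measure.map X' μ' = Measure.map X μ := by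
  refine Measure.ext_of_singleton fun x => ?_
  rw [Measure.map_apply hX (measurableSet_singleton x),
    Measure.map_apply hX' (measurableSet_singleton x)]
  exact (ENNReal.toReal_eq_toReal_iff' (measure_ne_top _ _) (measure_ne_top _ _)).1 (congrFun h x)

theorem mi_comp_symm_mul_log {A B 𝒰 𝒱 𝒳 : Type*} [Fintype A] [Fintype B] [Fintype 𝒰] [Fintype 𝒱]
    [Fintype 𝒳] [MeasurableSpace B] [MeasurableSingletonClass B] {ν : Measure B}
    [IsFiniteMeasure ν] {w : A → ℝ} (e : A ≃ B) (hν : pm ν id = pushMass w e) (k : 𝒰 ≃ 𝒱)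
    (U : A → 𝒰) (X : A → 𝒳) :
    mi ν (fun b => k (U (e.symm b))) (fun b => X (e.symm b)) * log 2 =
      massEnt (pushMass w U) + massEnt (pushMass w X)
        - massEnt (pushMass w fun a => (U a, X a)) := by
  have hlog : log 2 ≠ 0 := (log_pos one_lt_two).ne'
  have hk : massEnt (pushMass w fun a => k (U a)) = massEnt (pushMass w U) := by
    rw [← massEnt_pushMass_of_injective (pushMass w U) k.injective, pushMass_pushMass]
    rfl
  have hkX : massEnt (pushMass w fun a => (k (U a), X a)) =
      massEnt (pushMass w fun a => (U a, X a)) := by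
    rw [← massEnt_pushMass_of_injective (pushMass w fun a => (U a, X a))
      (k.injective.prodMap Function.injective_id), pushMass_pushMass]
    rfl
  rw [mi, ent_eq_massEnt, ent_eq_massEnt, ent_eq_massEnt, pm_comp_symm e hν fun a => k (U a),
    pm_comp_symm e hν X, pm_comp_symm e hν fun a => (k (U a), X a), hk, hkX]
  field_simp

/-- A tightness hypothesis over all probability spaces, restated for mass functions on finite
types of arbitrary universe levels, with entropies in nats. -/
theorem massEnt_le_of_tight
    {Ω : Type*} [MeasurableSpace Ω] (μ : Measure Ω) [IsProbabilityMeasure μ]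
    {𝒮 𝒴 : Type*}
    [Fintype 𝒮] [MeasurableSpace 𝒮] [MeasurableSingletonClass 𝒮]
    [Fintype 𝒴] [MeasurableSpace 𝒴] [MeasurableSingletonClass 𝒴]
    (S : Ω → 𝒮) (Y : Ω → 𝒴) (hS : Measurable S) (hY : Measurable Y) (ε c : ℝ)
    (htight : ∀ (Ω' : Type) [MeasurableSpace Ω'] (μ' : Measure Ω'),
        IsProbabilityMeasure μ' →
        ∀ (S' : Ω' → 𝒮) (Y' : Ω' → 𝒴), Measurable S' → Measurable Y' →
        Measure.map (fun ω => (S' ω, Y' ω)) μ' = Measure.map (fun ω => (S ω, Y ω)) μ →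
        ∀ (𝒰 : Type) [Fintype 𝒰] [Nonempty 𝒰]
          [MeasurableSpace 𝒰] [MeasurableSingletonClass 𝒰] (U : Ω' → 𝒰),
        Measurable U → mi μ' U S' ≤ ε → mi μ' U Y' ≤ c)
    {A : Type*} [Fintype A] {w : A → ℝ} (hw : ∀ a, 0 ≤ w a) (hw1 : ∑ a, w a = 1)
    (S' : A → 𝒮) (Y' : A → 𝒴)
    (hmap : pushMass w (fun a => (S' a, Y' a)) = pm μ (fun ω => (S ω, Y ω)))
    {𝒰 : Type*} [Fintype 𝒰] [Nonempty 𝒰] (U : A → 𝒰)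
    (hU : massEnt (pushMass w U) + massEnt (pushMass w S')
      - massEnt (pushMass w fun a => (U a, S' a)) ≤ ε * log 2) :
    massEnt (pushMass w U) + massEnt (pushMass w Y')
      - massEnt (pushMass w fun a => (U a, Y' a)) ≤ c * log 2 := by
  have hlog : 0 < log 2 := log_pos one_lt_two
  let e := Fintype.equivFin A
  let k := Fintype.equivFin 𝒰
  have hN : ∑ i, pushMass w e i = 1 := by rw [sum_pushMass, hw1]
  have hN0 : ∀ i, 0 ≤ pushMass w e i := fun i => by
    rw [← e.apply_symm_apply i, pushMass_apply_of_injective w e.injective]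
    exact hw _
  obtain ⟨ν, hν, hνw⟩ := exists_measure_pm_id hN0 hN
  have hU' : mi ν (fun i => k (U (e.symm i))) (fun i => S' (e.symm i)) ≤ ε := by
    rw [← mul_le_mul_iff_left₀ hlog, mi_comp_symm_mul_log e hνw]
    exact hU
  have : Nonempty (Fin (Fintype.card 𝒰)) := k.symm.nonempty
  rw [← mi_comp_symm_mul_log e hνw k U Y', mul_le_mul_iff_left₀ hlog]
  refine htight _ ν hν _ _ (measurable_of_finite _) (measurable_of_finite _) ?_ _ _
    (measurable_of_finite _) hU'
  refine map_eq_map_of_pm_eq (hS.prodMk hY) (measurable_of_finite _) ?_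
  rw [pm_comp_symm e hνw fun a => (S' a, Y' a), hmap]

section FunctionalRepresentation

variable {𝒮 𝒴 : Type*} [Fintype 𝒮] {P : 𝒮 → ℝ} {K : 𝒮 → 𝒴 → ℝ} {α : ℝ}

/-- The mass function of a random function with independent values of law `K s`. -/
def funMass (K : 𝒮 → 𝒴 → ℝ) (f : 𝒮 → 𝒴) : ℝ := ∏ s, K s (f s)

theorem funMass_nonneg (hK : ∀ s y, 0 ≤ K s y) (f : 𝒮 → 𝒴) : 0 ≤ funMass K f :=
  Finset.prod_nonneg fun s _ => hK s (f s)

/-- The joint mass function of a source `s` of law `P`, an independent random function `f` and an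
independent coin that shows `true` with probability `α`. -/
def reprMass (P : 𝒮 → ℝ) (K : 𝒮 → 𝒴 → ℝ) (α : ℝ) (a : 𝒮 × (𝒮 → 𝒴) × Bool) : ℝ :=
  P a.1 * (funMass K a.2.1 * bif a.2.2 then α else 1 - α)

/-- The random function together with the source, which is erased if the coin shows `false`. -/
def reprAux (a : 𝒮 × (𝒮 → 𝒴) × Bool) : (𝒮 → 𝒴) × Option 𝒮 :=
  (a.2.1, bif a.2.2 then some a.1 else none)

theorem reprMass_nonneg (hP : ∀ s, 0 ≤ P s) (hK : ∀ s y, 0 ≤ K s y) (hα : 0 ≤ α) (hα1 : α ≤ 1)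
    (a : 𝒮 × (𝒮 → 𝒴) × Bool) : 0 ≤ reprMass P K α a := by
  refine mul_nonneg (hP _) (mul_nonneg (funMass_nonneg hK _) ?_)
  cases a.2.2 <;> simp [hα, hα1]

variable [Fintype 𝒴]

/-- A joint mass function factors as its first marginal times a transition kernel. -/
theorem exists_kernel [Nonempty 𝒴] {p : 𝒮 × 𝒴 → ℝ} (hp : ∀ x, 0 ≤ p x) :
    ∃ K : 𝒮 → 𝒴 → ℝ, (∀ s y, 0 ≤ K s y) ∧ (∀ s, ∑ y, K s y = 1) ∧
      ∀ s y, pushMass p Prod.fst s * K s y = p (s, y) := by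
  classical
  have hP : ∀ s, pushMass p Prod.fst s = ∑ y, p (s, y) := fun s => by
    simp only [pushMass_apply, Fintype.sum_prod_type_right]
    simp
  have hP0 : ∀ s, 0 ≤ pushMass p Prod.fst s := fun s => by
    rw [hP]
    exact Finset.sum_nonneg fun _ _ => hp _
  refine ⟨fun s y => if pushMass p Prod.fst s = 0 then (Fintype.card 𝒴 : ℝ)⁻¹
    else p (s, y) / pushMass p Prod.fst s, fun s y => ?_, fun s => ?_, fun s y => ?_⟩
  · beta_reduce
    split_ifs
    · positivity
    · exact div_nonneg (hp _) (hP0 s)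
  · beta_reduce
    split_ifs with h
    · simp
    · rw [← Finset.sum_div, ← hP, div_self h]
  · beta_reduce
    split_ifs with h
    · rw [h, zero_mul]
      rw [hP, Finset.sum_eq_zero_iff_of_nonneg fun _ _ => hp _] at h
      exact (h y (Finset.mem_univ y)).symm
    · exact mul_div_cancel₀ _ h

theorem sum_funMass [DecidableEq 𝒮] (hK : ∀ s, ∑ y, K s y = 1) : ∑ f, funMass K f = 1 := by
  simp only [funMass, ← Fintype.prod_sum, hK, Finset.prod_const_one]

theorem sum_ite_funMass [DecidableEq 𝒮] [DecidableEq 𝒴] (hK : ∀ s, ∑ y, K s y = 1) (s : 𝒮)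
    (y : 𝒴) : (∑ f, if f s = y then funMass K f else 0) = K s y := by
  have h : ∀ f : 𝒮 → 𝒴, (if f s = y then funMass K f else 0) =
      ∏ t, if t = s then (if f t = y then K t (f t) else 0) else K t (f t) := by
    intro f
    split_ifs with hf
    · refine Finset.prod_congr rfl fun t _ => ?_
      split_ifs with hts hfy
      · rfl
      · exact absurd (hts ▸ hf) hfy
      · rfl
    · exact (Finset.prod_eq_zero (Finset.mem_univ s) (by simp [hf])).symm
  simp_rw [h]
  rw [← Fintype.prod_sum fun t z => if t = s then (if z = y then K t z else 0) else K t z,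
    Finset.prod_eq_single s]
  · simp
  · intro t _ hts
    simp [hts, hK]
  · simp

theorem massEnt_coin :
    massEnt (fun b : Bool => bif b then α else 1 - α) = negMulLog α + negMulLog (1 - α) := by
  simp [massEnt]

theorem massEnt_reprMass [DecidableEq 𝒮] (hP : ∑ s, P s = 1) (hK : ∀ s, ∑ y, K s y = 1) :
    massEnt (reprMass P K α) =
      massEnt P + (massEnt (funMass K) + (negMulLog α + negMulLog (1 - α))) := by
  have hcoin : ∑ b : Bool, (bif b then α else 1 - α) = 1 := by simp
  rw [← massEnt_coin, ← massEnt_prod (sum_funMass hK) hcoin, ← massEnt_prod hP]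
  · rfl
  · rw [Fintype.sum_prod_type]
    simp only [← Finset.mul_sum, hcoin, mul_one, sum_funMass hK]

theorem pushMass_reprMass_aux [DecidableEq 𝒮] (hP : ∑ s, P s = 1) :
    pushMass (reprMass P K α) reprAux =
      fun x => funMass K x.1 * x.2.elim (1 - α) (fun s => α * P s) := by
  classical
  ext ⟨f, o⟩
  rw [pushMass_apply]
  cases o with
  | none =>
    simp [Fintype.sum_prod_type, reprMass, reprAux, ← Finset.sum_mul, hP]
  | some s =>
    simp [Fintype.sum_prod_type, reprMass, reprAux, ite_and]
    ring

theorem massEnt_reprMass_aux [DecidableEq 𝒮] (hP : ∑ s, P s = 1) (hK : ∀ s, ∑ y, K s y = 1) :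
    massEnt (pushMass (reprMass P K α) reprAux) =
      massEnt (funMass K) + (negMulLog α + negMulLog (1 - α)) + α * massEnt P := by
  have h1 : ∑ o : Option 𝒮, o.elim (1 - α) (fun s => α * P s) = 1 := by
    simp [Fintype.sum_option, ← Finset.mul_sum, hP]
  rw [pushMass_reprMass_aux hP, massEnt_prod (sum_funMass hK) h1]
  simp only [massEnt, Fintype.sum_option, Option.elim, negMulLog_mul, Finset.sum_add_distrib,
    ← Finset.sum_mul, ← Finset.mul_sum, hP]
  ring

theorem pushMass_reprMass_joint [DecidableEq 𝒮] (hK : ∀ s, ∑ y, K s y = 1) :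
    pushMass (reprMass P K α) (fun a => (a.1, a.2.1 a.1)) = fun x => P x.1 * K x.1 x.2 := by
  classical
  ext ⟨s, y⟩
  rw [pushMass_apply, ← sum_ite_funMass hK, Finset.mul_sum]
  simp only [Fintype.sum_prod_type, reprMass, Prod.mk.injEq, ite_and]
  rw [Finset.sum_eq_single s]
  · refine Finset.sum_congr rfl fun f _ => ?_
    simp
    split_ifs <;> ring
  · intro t _ hts
    simp [hts]
  · simp

/-- If `y` has positive probability given two distinct source symbols and the coin may show
`false`, then the auxiliary variable and `y` do not determine the source. -/
theorem massEnt_reprMass_aux_output_lt [DecidableEq 𝒮] (hP : ∀ s, 0 ≤ P s) (hK : ∀ s y, 0 ≤ K s y)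
    (hK1 : ∀ s, ∑ y, K s y = 1) (hα : 0 ≤ α) (hα1 : α < 1) {s t : 𝒮} {y : 𝒴} (hst : s ≠ t)
    (hs : 0 < P s * K s y) (ht : 0 < P t * K t y) :
    massEnt (pushMass (reprMass P K α) fun a => (reprAux a, a.2.1 a.1)) <
      massEnt (reprMass P K α) := by
  classical
  have hpos : ∀ r, ∃ z, 0 < K r z := by
    intro r
    by_contra! h
    have := Finset.sum_nonpos fun z (_ : z ∈ Finset.univ) => h z
    rw [hK1] at this
    linarith
  choose g hg using hpos
  let f : 𝒮 → 𝒴 := fun r => if r = s ∨ r = t then y else g r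
  have hf : 0 < funMass K f := by
    refine Finset.prod_pos fun r _ => ?_
    by_cases h : r = s ∨ r = t
    · have hfr : f r = y := if_pos h
      rw [hfr]
      rcases h with rfl | rfl
      · exact pos_of_mul_pos_right hs (hP _)
      · exact pos_of_mul_pos_right ht (hP _)
    · have hfr : f r = g r := if_neg h
      rw [hfr]
      exact hg r
  have hw : ∀ r, 0 < P r * K r y → 0 < reprMass P K α (r, f, false) := fun r hr =>
    mul_pos (pos_of_mul_pos_left hr (hK _ _)) (mul_pos hf (sub_pos.2 hα1))
  refine massEnt_pushMass_lt (reprMass_nonneg hP hK hα hα1.le) (a := (s, f, false))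
    (b := (t, f, false)) (by simp [hst]) ?_ (hw s hs) (hw t ht)
  simp [reprAux, f]

theorem massEnt_reprMass_aux_source [DecidableEq 𝒮] :
    massEnt (pushMass (reprMass P K α) fun a => (reprAux a, a.1)) = massEnt (reprMass P K α) := by
  refine massEnt_pushMass_of_injective _ ?_
  rintro ⟨s, f, b⟩ ⟨t, g, c⟩ h
  cases b <;> cases c <;> simp_all [reprAux]

end FunctionalRepresentation

/-- converse tightness of `L_h^1(ε)` in Theorem 1. If for every probability
space carrying `(S',Y')` distributed as `(S,Y)` and every finite-valued `U` with `I(U;S') ≤ ε`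
one has `I(U;Y') ≤ H(Y) − H(S) + ε`, then `H(S|Y) = 0`. -/
theorem detS_of_L1_tight
    {Ω : Type*} [MeasurableSpace Ω] (μ : Measure Ω) [IsProbabilityMeasure μ]
    {𝒮 𝒴 : Type*}
    [Fintype 𝒮] [Nonempty 𝒮] [MeasurableSpace 𝒮] [MeasurableSingletonClass 𝒮]
    [Fintype 𝒴] [Nonempty 𝒴] [MeasurableSpace 𝒴] [MeasurableSingletonClass 𝒴]
    (S : Ω → 𝒮) (Y : Ω → 𝒴) (hS : Measurable S) (hY : Measurable Y)
    (ε : ℝ) (hε0 : 0 ≤ ε) (hε : ε < mi μ S Y)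
    (htight : ∀ (Ω' : Type) [MeasurableSpace Ω'] (μ' : Measure Ω'),
        IsProbabilityMeasure μ' →
        ∀ (S' : Ω' → 𝒮) (Y' : Ω' → 𝒴), Measurable S' → Measurable Y' →
        Measure.map (fun ω => (S' ω, Y' ω)) μ' = Measure.map (fun ω => (S ω, Y ω)) μ →
        ∀ (𝒰 : Type) [Fintype 𝒰] [Nonempty 𝒰]
          [MeasurableSpace 𝒰] [MeasurableSingletonClass 𝒰] (U : Ω' → 𝒰),
        Measurable U → mi μ' U S' ≤ ε → mi μ' U Y' ≤ ent μ Y - ent μ S + ε) :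
    condEnt μ S Y = 0 := by
  classical
  have hlog : 0 < log 2 := log_pos one_lt_two
  have hSY : ∀ x, MeasurableSet ((fun ω => (S ω, Y ω)) ⁻¹' {x}) := fun x =>
    hS.prodMk hY (measurableSet_singleton x)
  set p := pm μ fun ω => (S ω, Y ω) with hp_def
  have hp : ∀ x, 0 ≤ p x := fun _ => ENNReal.toReal_nonneg
  have hpS : pm μ S = pushMass p Prod.fst := pm_comp_s8 μ hSY Prod.fst
  have hpY : pm μ Y = pushMass p Prod.snd := pm_comp_s8 μ hSY Prod.snd
  obtain ⟨K, hK, hK1, hPK⟩ := exists_kernel hp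
  set P := pushMass p Prod.fst
  have hP : ∀ s, 0 ≤ P s := fun s => hpS ▸ ENNReal.toReal_nonneg
  have hP1 : ∑ s, P s = 1 := hpS ▸ sum_pm μ fun s => hS (measurableSet_singleton s)
  rw [condEnt, ent_eq_massEnt, ent_eq_massEnt, ← hp_def, hpY, sub_eq_zero]
  congr 1
  refine (massEnt_pushMass_eq ?_).symm
  rintro ⟨s, y⟩ ⟨t, z⟩ (rfl : y = z) hs ht
  by_contra hne
  have hst : s ≠ t := fun h => hne (h ▸ rfl)
  have hεP : ε * log 2 < massEnt P := by
    have h := massEnt_pushMass_le hp Prod.snd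
    rw [mi, ent_eq_massEnt, ent_eq_massEnt, ent_eq_massEnt, ← hp_def, hpS, hpY, ← add_div,
      ← sub_div, lt_div_iff₀ hlog] at hε
    linarith
  have hP_pos : 0 < massEnt P := (mul_nonneg hε0 hlog.le).trans_lt hεP
  obtain ⟨α, hα, hα1, hαP⟩ : ∃ α, 0 ≤ α ∧ α < 1 ∧ α * massEnt P = ε * log 2 :=
    ⟨ε * log 2 / massEnt P, by positivity, (div_lt_one hP_pos).2 hεP,
      div_mul_cancel₀ _ hP_pos.ne'⟩
  have hjoint : pushMass (reprMass P K α) (fun a => (a.1, a.2.1 a.1)) = p := by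
    rw [pushMass_reprMass_joint hK1]
    exact funext fun x => hPK x.1 x.2
  have hw1 : ∑ a, reprMass P K α a = 1 := by
    rw [← sum_pushMass _ fun a : 𝒮 × (𝒮 → 𝒴) × Bool => (a.1, a.2.1 a.1), hjoint]
    exact sum_pm μ hSY
  have hmargS : pushMass (reprMass P K α) (fun a => a.1) = P :=
    (pushMass_pushMass _ (fun a : 𝒮 × (𝒮 → 𝒴) × Bool => (a.1, a.2.1 a.1)) Prod.fst).symm.trans
      (congrArg (pushMass · Prod.fst) hjoint)
  have hmargY : pushMass (reprMass P K α) (fun a => a.2.1 a.1) = pushMass p Prod.snd :=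
    (pushMass_pushMass _ (fun a : 𝒮 × (𝒮 → 𝒴) × Bool => (a.1, a.2.1 a.1)) Prod.snd).symm.trans
      (congrArg (pushMass · Prod.snd) hjoint)
  have htot := massEnt_reprMass (α := α) hP1 hK1
  have haux := massEnt_reprMass_aux (α := α) hP1 hK1
  have hlt := massEnt_reprMass_aux_output_lt hP hK hK1 hα hα1 hst
    (hPK s y ▸ (hp _).lt_of_ne' hs) (hPK t y ▸ (hp _).lt_of_ne' ht)
  have hle := massEnt_le_of_tight μ S Y hS hY ε _ htight
    (reprMass_nonneg hP hK hα hα1.le) hw1 (fun a => a.1) (fun a => a.2.1 a.1) hjoint reprAux (by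
      rw [hmargS, massEnt_reprMass_aux_source, htot, haux]
      linarith)
  have hc : (ent μ Y - ent μ S + ε) * log 2 =
      massEnt (pushMass p Prod.snd) - massEnt P + ε * log 2 := by
    rw [ent_eq_massEnt, ent_eq_massEnt, hpS, hpY]
    field_simp
  rw [hmargY, hc, haux] at hle
  linarith
end
end
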